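/- arXiv:1708.04832 — 4 statements merged into one kernel-verified Lean document; each statement's English description precedes it below -/
import Mathlib

section
/- Let d be any compatible metric on X^Γ, let f : X^Γ → X^Γ be any map and let x, y ∈ X^Γ. Then the following are equivalent: (1) there exists s > 0 with F_{xy}(s) = 0; (2) there exists a finite subset D of Γ with G_{xy}(γ_D) = 0. -/
open Filter Topology

/-- `d : Y → Y → ℝ` is a metric on the topological space `Y` compatible with
(i.e. inducing) its topology. -/
def IsCompatibleMetric (Y : Type*) [t : TopologicalSpace Y] (d : Y → Y → ℝ) : Prop :=
  ∃ m : MetricSpace Y, m.toUniformSpace.toTopologicalSpace = t ∧ ∀ a b, m.dist a b = d a b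

/-- The generalized shift `σ_φ : X^Γ → X^Γ`, `σ_φ((x_α)_α) = (x_{φ(α)})_α`. -/
def genShift {X Γ : Type*} (φ : Γ → Γ) (x : Γ → X) : Γ → X := fun α => x (φ α)

/-- `θ` is a quasi-periodic point of `φ` iff its forward orbit `{φ^n(θ) : n ≥ 0}` is finite. -/
def QuasiPeriodic {Γ : Type*} (φ : Γ → Γ) (θ : Γ) : Prop :=
  (Set.range fun n : ℕ => φ^[n] θ).Finite

/-- `θ` is a periodic point of `φ` iff `φ^n(θ) = θ` for some `n ≥ 1`. -/
def PeriodicPt {Γ : Type*} (φ : Γ → Γ) (θ : Γ) : Prop := ∃ n ≥ 1, φ^[n] θ = θ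

/-- `ξ(x,y,t,n) = #{i ∈ {0,…,n−1} : d(f^i(x), f^i(y)) < t}`. -/
noncomputable def xiCount {Y : Type*} (d : Y → Y → ℝ) (f : Y → Y) (x y : Y) (t : ℝ) (n : ℕ) :
    ℕ :=
  {i : ℕ | i < n ∧ d (f^[i] x) (f^[i] y) < t}.ncard

/-- `F_{xy}(t) = liminf_n ξ(x,y,t,n)/n`. -/
noncomputable def Fdist {Y : Type*} (d : Y → Y → ℝ) (f : Y → Y) (x y : Y) (t : ℝ) : ℝ :=
  liminf (fun n : ℕ => (xiCount d f x y t n : ℝ) / n) atTop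

/-- `F*_{xy}(t) = limsup_n ξ(x,y,t,n)/n`. -/
noncomputable def FdistStar {Y : Type*} (d : Y → Y → ℝ) (f : Y → Y) (x y : Y) (t : ℝ) : ℝ :=
  limsup (fun n : ℕ => (xiCount d f x y t n : ℝ) / n) atTop

/-- `ζ(x,y,γ_D,n) = #{i ∈ {0,…,n−1} : (f^i(x), f^i(y)) ∈ γ_D}` where
`γ_D = {(u,v) : u_α = v_α for all α ∈ D}`. -/
noncomputable def zetaCount {X Γ : Type*} (f : (Γ → X) → (Γ → X)) (x y : Γ → X) (D : Set Γ)
    (n : ℕ) : ℕ :=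
  {i : ℕ | i < n ∧ ∀ α ∈ D, f^[i] x α = f^[i] y α}.ncard

/-- `G_{xy}(γ_D) = liminf_n ζ(x,y,γ_D,n)/n`. -/
noncomputable def Gdist {X Γ : Type*} (f : (Γ → X) → (Γ → X)) (x y : Γ → X) (D : Set Γ) : ℝ :=
  liminf (fun n : ℕ => (zetaCount f x y D n : ℝ) / n) atTop

/-- `G*_{xy}(γ_D) = limsup_n ζ(x,y,γ_D,n)/n`. -/
noncomputable def GdistStar {X Γ : Type*} (f : (Γ → X) → (Γ → X)) (x y : Γ → X) (D : Set Γ) :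
    ℝ :=
  limsup (fun n : ℕ => (zetaCount f x y D n : ℝ) / n) atTop

/-- `x, y` are distributionally scrambled of type 1 (w.r.t. the metric `d` and the map `f`). -/
def DistScrambled1 {Y : Type*} (d : Y → Y → ℝ) (f : Y → Y) (x y : Y) : Prop :=
  (∃ s > 0, Fdist d f x y s = 0) ∧ ∀ s > 0, FdistStar d f x y s = 1

/-- `x, y` are distributionally scrambled of type 2. -/
def DistScrambled2 {Y : Type*} (d : Y → Y → ℝ) (f : Y → Y) (x y : Y) : Prop :=
  (∃ s > 0, Fdist d f x y s < 1) ∧ ∀ s > 0, FdistStar d f x y s = 1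

/-- `x, y` are distributionally scrambled of type 3. -/
def DistScrambled3 {Y : Type*} (d : Y → Y → ℝ) (f : Y → Y) (x y : Y) : Prop :=
  ∃ a b : ℝ, 0 < a ∧ a < b ∧ ∀ s ∈ Set.Icc a b, Fdist d f x y s < FdistStar d f x y s

/-- `A` is a distributionally scrambled set of type 1: it has at least two elements and all
pairs of distinct points of `A` are distributionally scrambled of type 1. -/
def DistScrambledSet1 {Y : Type*} (d : Y → Y → ℝ) (f : Y → Y) (A : Set Y) : Prop :=
  A.Nontrivial ∧ ∀ x ∈ A, ∀ y ∈ A, x ≠ y → DistScrambled1 d f x y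

/-- `A` is a distributionally scrambled set of type 2. -/
def DistScrambledSet2 {Y : Type*} (d : Y → Y → ℝ) (f : Y → Y) (A : Set Y) : Prop :=
  A.Nontrivial ∧ ∀ x ∈ A, ∀ y ∈ A, x ≠ y → DistScrambled2 d f x y

/-- `A` is a distributionally scrambled set of type 3. -/
def DistScrambledSet3 {Y : Type*} (d : Y → Y → ℝ) (f : Y → Y) (A : Set Y) : Prop :=
  A.Nontrivial ∧ ∀ x ∈ A, ∀ y ∈ A, x ≠ y → DistScrambled3 d f x y

/-- `(Y,f)` is uniform distributionally chaotic: there is an uncountable distributionally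
scrambled set `A` of type 1 and a single `ε > 0` with `F_{xy}(ε) = 0` for distinct `x,y ∈ A`. -/
def UniformDC {Y : Type*} (d : Y → Y → ℝ) (f : Y → Y) : Prop :=
  ∃ A : Set Y, ¬ A.Countable ∧ DistScrambledSet1 d f A ∧
    ∃ ε > 0, ∀ x ∈ A, ∀ y ∈ A, x ≠ y → Fdist d f x y ε = 0

/-- `a` is a transitive point of `f`: its forward orbit is dense. -/
def TransitivePoint {Y : Type*} [TopologicalSpace Y] (f : Y → Y) (a : Y) : Prop :=
  Dense (Set.range fun n : ℕ => f^[n] a)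

/-- `(Y,f)` is dense distributionally chaotic: uniform distributional chaos witnessed by a
dense set. -/
def DenseDC {Y : Type*} [TopologicalSpace Y] (d : Y → Y → ℝ) (f : Y → Y) : Prop :=
  ∃ A : Set Y, ¬ A.Countable ∧ Dense A ∧ DistScrambledSet1 d f A ∧
    ∃ ε > 0, ∀ x ∈ A, ∀ y ∈ A, x ≠ y → Fdist d f x y ε = 0

/-- `(Y,f)` is transitive distributionally chaotic: uniform distributional chaos witnessed by a
dense set of transitive points. -/
def TransitiveDC {Y : Type*} [TopologicalSpace Y] (d : Y → Y → ℝ) (f : Y → Y) : Prop :=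
  ∃ A : Set Y, ¬ A.Countable ∧ Dense A ∧ (∀ a ∈ A, TransitivePoint f a) ∧
    DistScrambledSet1 d f A ∧
    ∃ ε > 0, ∀ x ∈ A, ∀ y ∈ A, x ≠ y → Fdist d f x y ε = 0

/-- The ω-limit set of `a` under `f`: all limits of `f^[n k] a` along strictly increasing
sequences `n`. -/
def OmegaSet {Y : Type*} [TopologicalSpace Y] (f : Y → Y) (a : Y) : Set Y :=
  {z | ∃ n : ℕ → ℕ, StrictMono n ∧ Tendsto (fun k => f^[n k] a) atTop (nhds z)}

/-- The set of periodic points of `f`. -/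
def PerSet {Y : Type*} (f : Y → Y) : Set Y := {y | ∃ n ≥ 1, f^[n] y = y}

/-- `x, y` are `ω^u`-scrambled. -/
def OmegaUScrambled {Y : Type*} [TopologicalSpace Y] (f : Y → Y) (x y : Y) : Prop :=
  ¬ (OmegaSet f x \ OmegaSet f y).Countable ∧
    (OmegaSet f x ∩ OmegaSet f y).Nonempty ∧ (OmegaSet f x \ PerSet f).Nonempty

/-- `x, y` are `ω^∞`-scrambled. -/
def OmegaInfScrambled {Y : Type*} [TopologicalSpace Y] (f : Y → Y) (x y : Y) : Prop :=
  (OmegaSet f x \ OmegaSet f y).Infinite ∧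
    (OmegaSet f x ∩ OmegaSet f y).Nonempty ∧ (OmegaSet f x \ PerSet f).Nonempty

/-- `A` is an `ω^u`-scrambled set. -/
def OmegaUScrambledSet {Y : Type*} [TopologicalSpace Y] (f : Y → Y) (A : Set Y) : Prop :=
  A.Nontrivial ∧ ∀ x ∈ A, ∀ y ∈ A, x ≠ y → OmegaUScrambled f x y

/-- `A` is an `ω^∞`-scrambled set. -/
def OmegaInfScrambledSet {Y : Type*} [TopologicalSpace Y] (f : Y → Y) (A : Set Y) : Prop :=
  A.Nontrivial ∧ ∀ x ∈ A, ∀ y ∈ A, x ≠ y → OmegaInfScrambled f x y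

variable {X : Type*} [Fintype X] [TopologicalSpace X] [DiscreteTopology X] [Nontrivial X]
variable {Γ : Type*} [Countable Γ] [Nonempty Γ]
/-- If the set of naturals satisfying `q` has lower density
zero and `p` implies `q`, then so does the set of naturals satisfying `p`. -/
theorem liminf_ncard_div_eq_zero_of_imp {p q : ℕ → Prop} (hpq : ∀ i, p i → q i)
    (hq : liminf (fun n : ℕ => ({i : ℕ | i < n ∧ q i}.ncard : ℝ) / n) atTop = 0) :
    liminf (fun n : ℕ => ({i : ℕ | i < n ∧ p i}.ncard : ℝ) / n) atTop = 0 := by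
  have hfin (r : ℕ → Prop) (n : ℕ) : {i : ℕ | i < n ∧ r i}.Finite :=
    (Set.finite_lt_nat n).subset fun _ hi => hi.1
  have hnonneg (r : ℕ → Prop) (n : ℕ) : (0 : ℝ) ≤ ({i : ℕ | i < n ∧ r i}.ncard : ℝ) / n := by
    positivity
  have hle (r : ℕ → Prop) (n : ℕ) : ({i : ℕ | i < n ∧ r i}.ncard : ℝ) / n ≤ 1 := by
    refine div_le_one_of_le₀ ?_ n.cast_nonneg
    have hsub : {i : ℕ | i < n ∧ r i} ⊆ Set.Iio n := fun _ hi => hi.1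
    exact_mod_cast (Set.ncard_le_ncard hsub (Set.finite_Iio n)).trans_eq (by simp)
  have hbdd (r : ℕ → Prop) : IsBoundedUnder (· ≥ ·) atTop
      fun n : ℕ => ({i : ℕ | i < n ∧ r i}.ncard : ℝ) / n :=
    isBoundedUnder_of ⟨0, hnonneg r⟩
  have hcobdd (r : ℕ → Prop) : IsCoboundedUnder (· ≥ ·) atTop
      fun n : ℕ => ({i : ℕ | i < n ∧ r i}.ncard : ℝ) / n :=
    (isBoundedUnder_of ⟨1, hle r⟩ : IsBoundedUnder (· ≤ ·) atTop _).isCoboundedUnder_ge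
  apply le_antisymm
  · rw [← hq]
    refine liminf_le_liminf (Eventually.of_forall fun n => ?_) (hbdd p) (hcobdd q)
    have h := Set.ncard_le_ncard (fun i (hi : i < n ∧ p i) => (⟨hi.1, hpq i hi.2⟩ : i < n ∧ q i))
      (hfin q n)
    exact div_le_div_of_nonneg_right (by exact_mod_cast h) n.cast_nonneg
  · exact le_liminf_of_le (hcobdd p) (Eventually.of_forall (hnonneg p))

/-- In a product of copies of a finite discrete space, the relations `γ_D` with `D` finite generate
the uniformity of any compatible metric. -/
theorem IsCompatibleMetric.exists_agree_and_exists_dist {A I : Type*} [Finite A]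
    [TopologicalSpace A] [DiscreteTopology A] {d : (I → A) → (I → A) → ℝ}
    (hd : IsCompatibleMetric (I → A) d) :
    (∀ s > 0, ∃ D : Set I, D.Finite ∧ ∀ u v, (∀ a ∈ D, u a = v a) → d u v < s) ∧
      ∀ D : Set I, D.Finite → ∃ s > 0, ∀ u v, d u v < s → ∀ a ∈ D, u a = v a := by
  obtain ⟨m, hm, hdist⟩ := hd
  have hbasis : (@uniformity (I → A) m.toUniformSpace).HasBasis (fun s : ℝ => 0 < s)
      fun s => {p | d p.1 p.2 < s} := by
    simp only [← hdist]
    exact Metric.uniformity_basis_dist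
  have hpi : @uniformity (I → A) m.toUniformSpace =
      ⨅ a : I, 𝓟 {p : (I → A) × (I → A) | p.1 a = p.2 a} := by
    let u : UniformSpace A := ⊥
    have hu : u.toTopologicalSpace = ‹TopologicalSpace A› :=
      UniformSpace.toTopologicalSpace_bot.trans DiscreteTopology.eq_bot.symm
    have htop : (Pi.uniformSpace fun _ : I => A).toTopologicalSpace = Pi.topologicalSpace := by
      rw [← hu]
      rfl
    rw [unique_uniformity_of_compact hm htop, Pi.uniformity]
    refine iInf_congr fun a => ?_
    rw [DiscreteUniformity.eq_principal_setRelId, comap_principal]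
    rfl
  refine ⟨fun s hs => ?_, fun D hD => ?_⟩
  · obtain ⟨D, hD, V, hV, h⟩ := mem_iInf.mp (hpi ▸ hbasis.mem_of_mem hs)
    refine ⟨D, hD, fun u v huv => ?_⟩
    have hmem : (u, v) ∈ {p : (I → A) × (I → A) | d p.1 p.2 < s} := by
      rw [h]
      exact Set.mem_iInter.mpr fun a => hV a (huv a a.2)
    exact hmem
  · have hmem : {p : (I → A) × (I → A) | ∀ a ∈ D, p.1 a = p.2 a} ∈
        @uniformity (I → A) m.toUniformSpace := by
      rw [hpi]
      simp only [Set.ofPred_forall]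
      exact (biInter_mem hD).mpr fun a _ => mem_iInf_of_mem a (mem_principal_self _)
    obtain ⟨s, hs, h⟩ := hbasis.mem_iff.mp hmem
    exact ⟨s, hs, fun u v huv => h (show (u, v) ∈ _ from huv)⟩

/-- for any compatible metric `d` on `X^Γ`, any map `f : X^Γ → X^Γ` and any
`x, y ∈ X^Γ`: `(∃ s > 0, F_{xy}(s) = 0) ↔ (∃ finite D ⊆ Γ, G_{xy}(γ_D) = 0)`. -/
theorem exists_F_eq_zero_iff_exists_finite_G_eq_zero
    (d : (Γ → X) → (Γ → X) → ℝ) (hd : IsCompatibleMetric (Γ → X) d)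
    (f : (Γ → X) → (Γ → X)) (x y : Γ → X) :
    (∃ s > 0, Fdist d f x y s = 0) ↔
      (∃ D : Set Γ, D.Finite ∧ Gdist f x y D = 0) := by
  obtain ⟨hagree, hdist⟩ := hd.exists_agree_and_exists_dist
  constructor
  · rintro ⟨s, hs, h⟩
    obtain ⟨D, hD, hDs⟩ := hagree s hs
    exact ⟨D, hD, liminf_ncard_div_eq_zero_of_imp (fun i => hDs (f^[i] x) (f^[i] y)) h⟩
  · rintro ⟨D, hD, h⟩
    obtain ⟨s, hs, hsD⟩ := hdist D hD
    exact ⟨s, hs, liminf_ncard_div_eq_zero_of_imp (fun i => hsD (f^[i] x) (f^[i] y)) h⟩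
end

section
/- Let d be any compatible metric on X^Γ, let f : X^Γ → X^Γ be any map and let x, y ∈ X^Γ. Then the following are equivalent: (1) for all s > 0 one has F*_{xy}(s) = 1; (2) for every finite subset D of Γ one has G*_{xy}(γ_D) = 1. -/
open Filter Topology

variable {X : Type*} [Fintype X] [TopologicalSpace X] [DiscreteTopology X] [Nontrivial X]
variable {Γ : Type*} [Countable Γ] [Nonempty Γ]

/-- The uniformity of a power of a discrete space is generated by the relations of agreeing on a
finite set of coordinates; in the compact case any compatible metric induces it. -/
theorem IsCompatibleMetric.mem_iInf_principal_iff {A ι : Type*} [Finite A] [TopologicalSpace A]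
    [DiscreteTopology A] {d : (ι → A) → (ι → A) → ℝ} (hd : IsCompatibleMetric (ι → A) d)
    (U : Set ((ι → A) × (ι → A))) :
    U ∈ (⨅ α : ι, 𝓟 {p : (ι → A) × (ι → A) | p.1 α = p.2 α}) ↔
      ∃ s > 0, ∀ u v, d u v < s → (u, v) ∈ U := by
  obtain ⟨m, hm, hdist⟩ := hd
  let _ : UniformSpace A := (⊥ : UniformSpace A).replaceTopology (by
    rw [DiscreteTopology.eq_bot (α := A)]; rfl)
  have hunif : m.toUniformSpace = Pi.uniformSpace (fun _ : ι => A) :=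
    unique_uniformity_of_compact hm rfl
  have hpi : uniformity (ι → A) = ⨅ α : ι, 𝓟 {p : (ι → A) × (ι → A) | p.1 α = p.2 α} := by
    rw [Pi.uniformity]
    refine iInf_congr fun α => ?_
    have h : uniformity A = 𝓟 SetRel.id := rfl
    rw [h, comap_principal]
    rfl
  rw [← hpi, ← hunif]
  refine (@Metric.mem_uniformity_dist _ m.toPseudoMetricSpace U).trans ?_
  exact exists_congr fun s => and_congr_right fun _ => forall₂_congr fun u v =>
    imp_congr_left (by rw [← hdist])

theorem IsCompatibleMetric.exists_finite_forall_eq_imp_lt {A ι : Type*} [Finite A]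
    [TopologicalSpace A] [DiscreteTopology A] {d : (ι → A) → (ι → A) → ℝ}
    (hd : IsCompatibleMetric (ι → A) d) {s : ℝ} (hs : 0 < s) :
    ∃ D : Set ι, D.Finite ∧ ∀ u v, (∀ α ∈ D, u α = v α) → d u v < s := by
  have h := (hd.mem_iInf_principal_iff {p | d p.1 p.2 < s}).2 ⟨s, hs, fun _ _ h => h⟩
  obtain ⟨D, hD, hsub⟩ := (hasBasis_iInf_principal_finite _).mem_iff.1 h
  exact ⟨D, hD, fun u v huv => @hsub (u, v) (Set.mem_iInter₂.2 huv)⟩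

theorem IsCompatibleMetric.exists_pos_forall_lt_imp_eq {A ι : Type*} [Finite A]
    [TopologicalSpace A] [DiscreteTopology A] {d : (ι → A) → (ι → A) → ℝ}
    (hd : IsCompatibleMetric (ι → A) d) {D : Set ι} (hD : D.Finite) :
    ∃ s > 0, ∀ u v, d u v < s → ∀ α ∈ D, u α = v α := by
  obtain ⟨s, hs, h⟩ :=
    (hd.mem_iInf_principal_iff _).1 ((hasBasis_iInf_principal_finite _).mem_of_mem hD)
  exact ⟨s, hs, fun u v huv => Set.mem_iInter₂.1 (h u v huv)⟩

theorem ncard_lt_and_div_le_one (p : ℕ → Prop) (n : ℕ) :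
    ({i : ℕ | i < n ∧ p i}.ncard : ℝ) / n ≤ 1 := by
  refine div_le_one_of_le₀ (Nat.cast_le.2 ?_) n.cast_nonneg
  calc {i : ℕ | i < n ∧ p i}.ncard ≤ (Set.Iio n).ncard :=
        Set.ncard_le_ncard (fun _ h => h.1) (Set.finite_Iio n)
    _ = n := by simp

/-- Upper density is monotone, so a set containing one of upper density `1` has upper density
`1`. -/
theorem limsup_ncard_div_eq_one_of_imp {p q : ℕ → Prop} (hpq : ∀ i, p i → q i)
    (hp : limsup (fun n : ℕ => ({i : ℕ | i < n ∧ p i}.ncard : ℝ) / n) atTop = 1) :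
    limsup (fun n : ℕ => ({i : ℕ | i < n ∧ q i}.ncard : ℝ) / n) atTop = 1 := by
  have hbdd (r : ℕ → Prop) : IsBoundedUnder (· ≤ ·) atTop
      (fun n : ℕ => ({i : ℕ | i < n ∧ r i}.ncard : ℝ) / n) :=
    isBoundedUnder_of ⟨1, ncard_lt_and_div_le_one r⟩
  have hcobdd (r : ℕ → Prop) : IsCoboundedUnder (· ≤ ·) atTop
      (fun n : ℕ => ({i : ℕ | i < n ∧ r i}.ncard : ℝ) / n) :=
    (isBoundedUnder_of ⟨0, fun n => by positivity⟩ :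
      IsBoundedUnder (· ≥ ·) atTop _).isCoboundedUnder_flip
  refine le_antisymm ?_ (hp.symm.trans_le ?_)
  · exact limsup_le_of_le (hcobdd q) (.of_forall (ncard_lt_and_div_le_one q))
  · refine limsup_le_limsup (.of_forall fun n => ?_) (hcobdd p) (hbdd q)
    refine div_le_div_of_nonneg_right (Nat.cast_le.2 ?_) n.cast_nonneg
    exact Set.ncard_le_ncard (fun i h => ⟨h.1, hpq i h.2⟩)
      ((Set.finite_Iio n).subset fun _ h => h.1)

/-- for any compatible metric `d` on `X^Γ`, any map `f : X^Γ → X^Γ` and any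
`x, y ∈ X^Γ`: `(∀ s > 0, F*_{xy}(s) = 1) ↔ (∀ finite D ⊆ Γ, G*_{xy}(γ_D) = 1)`. -/
theorem forall_Fstar_eq_one_iff_forall_finite_Gstar_eq_one
    (d : (Γ → X) → (Γ → X) → ℝ) (hd : IsCompatibleMetric (Γ → X) d)
    (f : (Γ → X) → (Γ → X)) (x y : Γ → X) :
    (∀ s > 0, FdistStar d f x y s = 1) ↔
      (∀ D : Set Γ, D.Finite → GdistStar f x y D = 1) := by
  constructor
  · intro h D hD
    obtain ⟨s, hs, hsD⟩ := hd.exists_pos_forall_lt_imp_eq hD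
    exact limsup_ncard_div_eq_one_of_imp (fun i => hsD (f^[i] x) (f^[i] y)) (h s hs)
  · intro h s hs
    obtain ⟨D, hD, hDs⟩ := hd.exists_finite_forall_eq_imp_lt hs
    exact limsup_ncard_div_eq_one_of_imp (fun i => hDs (f^[i] x) (f^[i] y)) (h D hD)
end

section
/- If φ : Γ → Γ has at least one non-quasi-periodic point, then for any compatible metric d on X^Γ the generalized shift dynamical system (X^Γ, σ_φ) is uniform distributional chaotic. -/
open Filter Topology

/-- A continuous function on a product of compact discrete spaces depends, up to an error `s`,
on finitely many coordinates only. -/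
theorem exists_finset_forall_dist_lt {ι A E : Type*} [TopologicalSpace A] [DiscreteTopology A]
    [CompactSpace A] [PseudoMetricSpace E] {f : (ι → A) → E} (hf : Continuous f) {s : ℝ}
    (hs : 0 < s) :
    ∃ D : Finset ι, ∀ u v, (∀ α ∈ D, u α = v α) → dist (f u) (f v) < s := by
  classical
  have key (x : ι → A) :
      ∃ D : Finset ι, ∀ v, (∀ α ∈ D, v α = x α) → dist (f v) (f x) < s / 2 := by
    have ho : IsOpen {v | dist (f v) (f x) < s / 2} :=
      isOpen_lt (hf.dist continuous_const) continuous_const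
    obtain ⟨I, u, hu, hsub⟩ := isOpen_pi_iff.1 ho x (by simp [hs])
    exact ⟨I, fun v hv => hsub fun α hα => by rw [hv α hα]; exact (hu α hα).2⟩
  choose D hD using key
  obtain ⟨T, hT⟩ := CompactSpace.elim_nhds_subcover
    (fun x : ι → A => (D x : Set ι).pi fun α => {x α})
    (fun x => (isOpen_set_pi (D x).finite_toSet fun α _ => isOpen_discrete _).mem_nhds
      (by simp [Set.mem_pi]))
  refine ⟨T.biUnion D, fun u v huv => ?_⟩
  obtain ⟨x, hxT, hux⟩ := Set.mem_iUnion₂.1 (hT.ge (Set.mem_univ u))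
  have hu : ∀ α ∈ D x, u α = x α := fun α hα => hux α hα
  have hv : ∀ α ∈ D x, v α = x α := fun α hα =>
    (huv α (Finset.mem_biUnion.2 ⟨x, hxT, hα⟩)).symm.trans (hu α hα)
  have := dist_triangle_right (f u) (f v) (f x)
  linarith [hD x u hu, hD x v hv]

/-- An injective continuous map from a product of compact discrete spaces uniformly separates
points that differ in a fixed coordinate. -/
theorem exists_pos_forall_le_dist {ι A E : Type*} [TopologicalSpace A] [DiscreteTopology A]
    [CompactSpace A] [MetricSpace E] {f : (ι → A) → E} (hf : Continuous f)
    (hinj : Function.Injective f) (θ : ι) :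
    ∃ ε > 0, ∀ u v, u θ ≠ v θ → ε ≤ dist (f u) (f v) := by
  have hK : IsCompact {w : (ι → A) × (ι → A) | w.1 θ ≠ w.2 θ} :=
    ((isClosed_discrete {w : A × A | w.1 ≠ w.2}).preimage
      (f := fun w : (ι → A) × (ι → A) => (w.1 θ, w.2 θ)) (by fun_prop)).isCompact
  obtain ⟨ε, hε, h⟩ := hK.exists_forall_le' (f := fun w => dist (f w.1) (f w.2)) (a := 0)
    (by fun_prop) fun w hw => dist_pos.2 fun h => hw (by rw [hinj h])
  exact ⟨ε, hε, fun u v huv => h (u, v) huv⟩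

/-- If a property holds on most of infinitely many of the intervals `[2 ^ 2 ^ k, 2 ^ 2 ^ (k + 1))`,
then it has upper density one. -/
theorem frequently_ncard_not_le {P : ℕ → Prop} {C : ℕ}
    (h : ∃ᶠ k in atTop, ∀ i, 2 ^ 2 ^ k + C ≤ i → i + C < 2 ^ 2 ^ (k + 1) → P i) {δ : ℝ}
    (hδ : 0 < δ) :
    ∃ᶠ n : ℕ in atTop, 0 < n ∧ ({i | i < n ∧ ¬ P i}.ncard : ℝ) ≤ δ * n := by
  have hM : Tendsto (fun k : ℕ => 2 ^ 2 ^ k) atTop atTop :=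
    (tendsto_pow_atTop_atTop_of_one_lt (one_lt_two (α := ℕ))).comp
      (tendsto_pow_atTop_atTop_of_one_lt (one_lt_two (α := ℕ)))
  refine (hM.comp (tendsto_add_atTop_nat 1)).frequently ?_
  refine (h.and_eventually (hM.eventually_ge_atTop (2 * C + ⌈2 / δ⌉₊))).mono ?_
  rintro k ⟨hP, hk⟩
  simp only [Function.comp_apply]
  refine ⟨by positivity, ?_⟩
  have hsq : (2 : ℕ) ^ 2 ^ (k + 1) = 2 ^ 2 ^ k * 2 ^ 2 ^ k := by rw [pow_succ 2 k, pow_mul, sq]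
  rw [hsq] at hP ⊢
  generalize 2 ^ 2 ^ k = M at *
  have hsub : {i | i < M * M ∧ ¬ P i} ⊆
      ↑(Finset.range (M + C) ∪ Finset.Ico (M * M - C) (M * M)) := by
    rintro i ⟨hi, hn⟩
    simp only [Finset.coe_union, Set.mem_union, Finset.mem_coe, Finset.mem_range, Finset.mem_Ico]
    by_contra! hc
    exact hn (hP i hc.1 (by have := hc.2; omega))
  have hcard : {i | i < M * M ∧ ¬ P i}.ncard ≤ M + 2 * C := by
    refine (Set.ncard_le_ncard hsub (Finset.finite_toSet _)).trans ?_
    rw [Set.ncard_coe_finset]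
    refine (Finset.card_union_le _ _).trans ?_
    simp only [Finset.card_range, Nat.card_Ico]
    omega
  have hle : ({i | i < M * M ∧ ¬ P i}.ncard : ℝ) ≤ 2 * M := by
    have : {i | i < M * M ∧ ¬ P i}.ncard ≤ 2 * M := by omega
    exact_mod_cast this
  have hMδ : 2 / δ ≤ M := (Nat.le_ceil _).trans (by exact_mod_cast (by omega))
  have h2 : 2 ≤ δ * M := by rwa [div_le_iff₀' hδ] at hMδ
  push_cast
  nlinarith [(Nat.cast_nonneg M : (0 : ℝ) ≤ M)]

theorem xiCount_le {Y : Type*} (d : Y → Y → ℝ) (f : Y → Y) (x y : Y) (t : ℝ) (n : ℕ) :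
    xiCount d f x y t n ≤ n := by
  have h : {i : ℕ | i < n ∧ d (f^[i] x) (f^[i] y) < t} ⊆ ↑(Finset.range n) :=
    fun i hi => by simpa using hi.1
  simpa [xiCount, Set.ncard_coe_finset] using Set.ncard_le_ncard h (Finset.finite_toSet _)

theorem xiCount_div_mem_Icc {Y : Type*} (d : Y → Y → ℝ) (f : Y → Y) (x y : Y) (t : ℝ) (n : ℕ) :
    (xiCount d f x y t n : ℝ) / n ∈ Set.Icc 0 1 :=
  ⟨by positivity, div_le_one_of_le₀ (by exact_mod_cast xiCount_le d f x y t n) (by positivity)⟩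

theorem isBoundedUnder_le_xiCount_div {Y : Type*} (d : Y → Y → ℝ) (f : Y → Y) (x y : Y) (t : ℝ) :
    IsBoundedUnder (· ≤ ·) atTop fun n : ℕ => (xiCount d f x y t n : ℝ) / n :=
  isBoundedUnder_of ⟨1, fun n => (xiCount_div_mem_Icc d f x y t n).2⟩

theorem isBoundedUnder_ge_xiCount_div {Y : Type*} (d : Y → Y → ℝ) (f : Y → Y) (x y : Y) (t : ℝ) :
    IsBoundedUnder (· ≥ ·) atTop fun n : ℕ => (xiCount d f x y t n : ℝ) / n :=
  isBoundedUnder_of ⟨0, fun n => (xiCount_div_mem_Icc d f x y t n).1⟩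

theorem FdistStar_eq_one {Y : Type*} {d : Y → Y → ℝ} {f : Y → Y} {x y : Y} {t : ℝ} {C : ℕ}
    (h : ∃ᶠ k in atTop, ∀ i, 2 ^ 2 ^ k + C ≤ i → i + C < 2 ^ 2 ^ (k + 1) →
      d (f^[i] x) (f^[i] y) < t) : FdistStar d f x y t = 1 := by
  refine le_antisymm (limsup_le_of_le
    (isBoundedUnder_ge_xiCount_div d f x y t).isCoboundedUnder_le
    (.of_forall fun n => (xiCount_div_mem_Icc d f x y t n).2)) ?_
  refine le_of_forall_sub_le fun δ hδ => ?_
  refine le_limsup_of_frequently_le ?_ (isBoundedUnder_le_xiCount_div d f x y t)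
  refine (frequently_ncard_not_le h hδ).mono ?_
  rintro n ⟨hn, hle⟩
  have hn' : (0 : ℝ) < n := by exact_mod_cast hn
  rw [le_div_iff₀ hn']
  have hcover : (Finset.range n : Set ℕ) ⊆ {i | i < n ∧ d (f^[i] x) (f^[i] y) < t} ∪
      {i | i < n ∧ ¬ d (f^[i] x) (f^[i] y) < t} := fun i hi => by
    have hi : i < n := by simpa using hi
    by_cases hc : d (f^[i] x) (f^[i] y) < t
    exacts [.inl ⟨hi, hc⟩, .inr ⟨hi, hc⟩]
  have hcard := (Set.ncard_le_ncard hcover (((Set.finite_lt_nat n).subset fun i hi => hi.1).union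
    ((Set.finite_lt_nat n).subset fun i hi => hi.1))).trans (Set.ncard_union_le _ _)
  rw [Set.ncard_coe_finset, Finset.card_range] at hcard
  have hcard' : (n : ℝ) ≤ xiCount d f x y t n +
      ({i | i < n ∧ ¬ d (f^[i] x) (f^[i] y) < t}.ncard : ℝ) := by exact_mod_cast hcard
  linarith

theorem Fdist_eq_zero {Y : Type*} {d : Y → Y → ℝ} {f : Y → Y} {x y : Y} {t : ℝ} {C : ℕ}
    (h : ∃ᶠ k in atTop, ∀ i, 2 ^ 2 ^ k + C ≤ i → i + C < 2 ^ 2 ^ (k + 1) →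
      t ≤ d (f^[i] x) (f^[i] y)) : Fdist d f x y t = 0 := by
  refine le_antisymm ?_ (le_liminf_of_le
    (isBoundedUnder_le_xiCount_div d f x y t).isCoboundedUnder_ge
    (.of_forall fun n => (xiCount_div_mem_Icc d f x y t n).1))
  refine le_of_forall_pos_le_add fun δ hδ => ?_
  refine liminf_le_of_frequently_le ?_ (isBoundedUnder_ge_xiCount_div d f x y t)
  refine (frequently_ncard_not_le h hδ).mono ?_
  rintro n ⟨hn, hle⟩
  rw [zero_add, div_le_iff₀ (by exact_mod_cast hn)]
  simpa only [not_le, xiCount] using hle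

theorem iterate_genShift_apply {A ι : Type*} (φ : ι → ι) (x : ι → A) (i : ℕ) (α : ι) :
    (genShift φ)^[i] x α = x (φ^[i] α) := by
  induction i generalizing x with
  | zero => rfl
  | succ i ih => rw [Function.iterate_succ_apply, ih, genShift, Function.iterate_succ_apply']

theorem injective_iterate_of_not_quasiPeriodic {ι : Type*} {φ : ι → ι} {θ : ι}
    (h : ¬ QuasiPeriodic φ θ) : Function.Injective fun n : ℕ => φ^[n] θ := by
  intro a b hab
  by_contra hne
  wlog hlt : a < b generalizing a b
  · exact this hab.symm (Ne.symm hne) (by omega)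
  refine h (((Set.finite_lt_nat b).image fun n => φ^[n] θ).subset ?_)
  rintro _ ⟨n, rfl⟩
  induction n using Nat.strong_induction_on with
  | _ n ih =>
    by_cases hn : n < b
    · exact ⟨n, hn, rfl⟩
    · have : φ^[n] θ = φ^[n - (b - a)] θ := by
        calc φ^[n] θ = φ^[n - b] (φ^[b] θ) := by
              rw [← Function.iterate_add_apply, Nat.sub_add_cancel (not_lt.1 hn)]
          _ = φ^[n - b] (φ^[a] θ) := by rw [show φ^[a] θ = φ^[b] θ from hab]
          _ = φ^[n - (b - a)] θ := by
              rw [← Function.iterate_add_apply]; congr 2; omega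
      simp only [this]
      exact ih _ (by omega)

/-- The code that is `false` at even places and repeats each `a m` infinitely often at odd
places. -/
def blockCode (a : ℕ → Bool) (k : ℕ) : Bool := k.bodd && a (Nat.unpair k.div2).1

theorem frequently_blockCode_eq (a b : ℕ → Bool) :
    ∃ᶠ k in atTop, blockCode a k = blockCode b k :=
  frequently_atTop.2 fun N => ⟨2 * N, by omega, by simp [blockCode]⟩

theorem frequently_blockCode_ne {a b : ℕ → Bool} (h : a ≠ b) :
    ∃ᶠ k in atTop, blockCode a k ≠ blockCode b k := by
  obtain ⟨m, hm⟩ := Function.ne_iff.1 h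
  refine frequently_atTop.2 fun N => ⟨2 * Nat.pair m N + 1, ?_, ?_⟩
  · have := Nat.right_le_pair m N
    omega
  · simpa [blockCode, Nat.div2_val, show (2 * Nat.pair m N + 1) / 2 = Nat.pair m N by omega]

open Classical in
/-- The point of `A ^ ι` that, along the orbit of `θ`, is constant on each of the blocks
`[2 ^ 2 ^ k, 2 ^ 2 ^ (k + 1))`, with value `q` or `p` according to `blockCode a k`, and that is `p`
off the orbit. -/
noncomputable def blockPoint {A ι : Type*} (φ : ι → ι) (θ : ι) (p q : A) (a : ℕ → Bool) :
    ι → A := fun α =>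
  if ∃ n, φ^[n] θ = α ∧ blockCode a (Nat.log 2 (Nat.log 2 n)) then q else p

theorem blockPoint_iterate {A ι : Type*} {φ : ι → ι} {θ : ι}
    (h : Function.Injective fun n : ℕ => φ^[n] θ) (p q : A) (a : ℕ → Bool) {n k : ℕ}
    (h₁ : 2 ^ 2 ^ k ≤ n) (h₂ : n < 2 ^ 2 ^ (k + 1)) :
    blockPoint φ θ p q a (φ^[n] θ) = if blockCode a k then q else p := by
  have hn : n ≠ 0 := (lt_of_lt_of_le (by positivity) h₁).ne'
  have h₁' : 2 ^ k ≤ Nat.log 2 n := Nat.le_log_of_pow_le one_lt_two h₁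
  have h₂' : Nat.log 2 n < 2 ^ (k + 1) := Nat.log_lt_of_lt_pow hn h₂
  have hk : Nat.log 2 (Nat.log 2 n) = k := Nat.log_eq_of_pow_le_of_lt_pow h₁' h₂'
  have : (∃ m, φ^[m] θ = φ^[n] θ ∧ blockCode a (Nat.log 2 (Nat.log 2 m)) = true) ↔
      blockCode a k = true := by
    constructor
    · rintro ⟨m, hm, hc⟩
      rwa [h hm, hk] at hc
    · exact fun hc => ⟨n, rfl, by rwa [hk]⟩
  simp only [blockPoint, this]

/-- Two block points whose codes agree at `k` agree at `φ^[i] α` for all `i` in the `k`-th block,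
up to a margin depending on `α` only. -/
theorem exists_margin_blockPoint_eq {A ι : Type*} {φ : ι → ι} {θ : ι}
    (h : Function.Injective fun n : ℕ => φ^[n] θ) (p q : A) (a b : ℕ → Bool) (α : ι) :
    ∃ C : ℕ, ∀ k, blockCode a k = blockCode b k → ∀ i, 2 ^ 2 ^ k + C ≤ i →
      i + C < 2 ^ 2 ^ (k + 1) →
      blockPoint φ θ p q a (φ^[i] α) = blockPoint φ θ p q b (φ^[i] α) := by
  by_cases hα : ∃ j m, φ^[j] α = φ^[m] θ
  · obtain ⟨j, m, hjm⟩ := hα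
    refine ⟨j + m, fun k hk i h₁ h₂ => ?_⟩
    have : φ^[i] α = φ^[i - j + m] θ := by
      rw [Function.iterate_add_apply, ← hjm, ← Function.iterate_add_apply,
        Nat.sub_add_cancel (by linarith [Nat.zero_le (2 ^ 2 ^ k)])]
    rw [this, blockPoint_iterate (k := k) h p q a (by omega) (by omega),
      blockPoint_iterate (k := k) h p q b (by omega) (by omega), hk]
  · have hoff : ∀ c i, blockPoint φ θ p q c (φ^[i] α) = p := fun c i =>
      if_neg fun ⟨n, hn, _⟩ => hα ⟨i, n, hn.symm⟩
    exact ⟨0, fun k _ i _ _ => by rw [hoff, hoff]⟩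

variable {X : Type*} [Fintype X] [TopologicalSpace X] [DiscreteTopology X] [Nontrivial X]
variable {Γ : Type*} [Countable Γ] [Nonempty Γ]
/-- if `φ` has a non-quasi-periodic point, then for any compatible metric `d`
on `X^Γ` the generalized shift `(X^Γ, σ_φ)` is uniform distributionally chaotic. -/
theorem uniformDC_of_exists_not_quasiPeriodic
    (φ : Γ → Γ) (hφ : ∃ θ : Γ, ¬ QuasiPeriodic φ θ)
    (d : (Γ → X) → (Γ → X) → ℝ) (hd : IsCompatibleMetric (Γ → X) d) :
    UniformDC d (genShift (X := X) φ) := by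
  obtain ⟨θ, hθ⟩ := hφ
  have hinj := injective_iterate_of_not_quasiPeriodic hθ
  obtain ⟨m, hm, hmd⟩ := hd
  have hcont : @Continuous (Γ → X) (Γ → X) _ m.toUniformSpace.toTopologicalSpace id :=
    continuous_id_iff_le.2 hm.ge
  obtain ⟨p, q, hpq⟩ := exists_pair_ne X
  obtain ⟨ε, hε, hsep⟩ := @exists_pos_forall_le_dist Γ X (Γ → X) _ _ _ m id hcont
    Function.injective_id θ
  have hF : ∀ a b : ℕ → Bool, a ≠ b →
      Fdist d (genShift φ) (blockPoint φ θ p q a) (blockPoint φ θ p q b) ε = 0 := by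
    refine fun a b hab => Fdist_eq_zero (C := 0) ((frequently_blockCode_ne hab).mono ?_)
    intro k hk i h₁ h₂
    rw [← hmd]
    refine hsep _ _ ?_
    rw [iterate_genShift_apply, iterate_genShift_apply, blockPoint_iterate hinj p q a h₁ h₂,
      blockPoint_iterate hinj p q b h₁ h₂]
    cases ha : blockCode a k <;> cases hb : blockCode b k <;> simp_all [hpq.symm]
  have hFs : ∀ a b : ℕ → Bool, ∀ s > 0,
      FdistStar d (genShift φ) (blockPoint φ θ p q a) (blockPoint φ θ p q b) s = 1 := by
    intro a b s hs
    obtain ⟨D, hD⟩ := @exists_finset_forall_dist_lt Γ X (Γ → X) _ _ _ m.toPseudoMetricSpace id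
      hcont s hs
    choose C hC using exists_margin_blockPoint_eq hinj p q a b
    refine FdistStar_eq_one (C := D.sup C) ((frequently_blockCode_eq a b).mono ?_)
    intro k hk i h₁ h₂
    rw [← hmd]
    refine hD _ _ fun α hα => ?_
    have := Finset.le_sup (f := C) hα
    rw [iterate_genShift_apply, iterate_genShift_apply]
    exact hC α k hk i (by omega) (by omega)
  have hne : Function.Injective (blockPoint φ θ p q) := by
    intro a b hab
    by_contra hne
    obtain ⟨k, hk⟩ := (frequently_blockCode_ne hne).exists
    have hlt : 2 ^ 2 ^ k < 2 ^ 2 ^ (k + 1) :=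
      Nat.pow_lt_pow_right one_lt_two (Nat.pow_lt_pow_right one_lt_two k.lt_succ_self)
    have := congrFun hab (φ^[2 ^ 2 ^ k] θ)
    rw [blockPoint_iterate hinj p q a le_rfl hlt, blockPoint_iterate hinj p q b le_rfl hlt] at this
    cases ha : blockCode a k <;> cases hb : blockCode b k <;> simp_all [hpq.symm]
  have huncount : ¬ (Set.range (blockPoint φ θ p q)).Countable := by
    intro h
    have := h.to_subtype
    have := Cardinal.mk_le_aleph0_iff.2 (Equiv.ofInjective _ hne).injective.countable
    simp [Cardinal.aleph0_lt_continuum.not_ge] at this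
  refine ⟨Set.range (blockPoint φ θ p q), huncount, ⟨?_, ?_⟩, ε, hε, ?_⟩
  · exact Set.not_subsingleton_iff.1 fun h => huncount h.countable
  · rintro _ ⟨a, rfl⟩ _ ⟨b, rfl⟩ hab
    exact ⟨⟨ε, hε, hF a b fun h => hab (h ▸ rfl)⟩, hFs a b⟩
  · rintro _ ⟨a, rfl⟩ _ ⟨b, rfl⟩ hab
    exact hF a b fun h => hab (h ▸ rfl)
end

section
/- For any compatible metric d on X^Γ, the following are equivalent: (X^Γ, σ_φ) is DC^u 1; (X^Γ, σ_φ) is DC^∞ 1; (X^Γ, σ_φ) is DC^2 1; (X^Γ, σ_φ) is DC^u 2; (X^Γ, σ_φ) is DC^∞ 2; (X^Γ, σ_φ) is DC^2 2; φ : Γ → Γ has at least one non-quasi-periodic point. -/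
open Filter Topology

/-! ### Counting densities -/

theorem ncard_lt_div_mem_Icc (P : ℕ → Prop) (n : ℕ) :
    (({i : ℕ | i < n ∧ P i}.ncard : ℝ) / n) ∈ Set.Icc (0 : ℝ) 1 := by
  refine ⟨by positivity, div_le_one_of_le₀ ?_ (Nat.cast_nonneg n)⟩
  have h : {i : ℕ | i < n ∧ P i}.ncard ≤ (Set.Iio n).ncard :=
    Set.ncard_le_ncard (fun i hi => hi.1) (Set.finite_Iio n)
  have h' : (Set.Iio n).ncard = n := by
    rw [← Finset.coe_Iio, Set.ncard_coe_finset, Nat.card_Iio]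
  exact_mod_cast h.trans_eq h'

theorem liminf_eq_zero_of_frequently_le {u : ℕ → ℝ} (hu : ∀ n, u n ∈ Set.Icc (0 : ℝ) 1)
    (h : ∀ ε > 0, ∃ᶠ n in atTop, u n ≤ ε) : liminf u atTop = 0 := by
  have hb : IsBoundedUnder (· ≥ ·) atTop u := isBoundedUnder_of ⟨0, fun n => (hu n).1⟩
  have hc : IsCoboundedUnder (· ≥ ·) atTop u :=
    (isBoundedUnder_of ⟨1, fun n => (hu n).2⟩ : IsBoundedUnder (· ≤ ·) atTop u).isCoboundedUnder_ge
  refine le_antisymm (le_of_forall_pos_le_add fun ε hε => ?_) ?_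
  · rw [zero_add]
    exact liminf_le_of_frequently_le (h ε hε) hb
  · exact le_liminf_of_le hc (Eventually.of_forall fun n => (hu n).1)

theorem limsup_eq_one_of_frequently_ge {u : ℕ → ℝ} (hu : ∀ n, u n ∈ Set.Icc (0 : ℝ) 1)
    (h : ∀ ε > 0, ∃ᶠ n in atTop, 1 - ε ≤ u n) : limsup u atTop = 1 := by
  have hb : IsBoundedUnder (· ≤ ·) atTop u := isBoundedUnder_of ⟨1, fun n => (hu n).2⟩
  have hc : IsCoboundedUnder (· ≤ ·) atTop u :=
    (isBoundedUnder_of ⟨0, fun n => (hu n).1⟩ : IsBoundedUnder (· ≥ ·) atTop u).isCoboundedUnder_le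
  refine le_antisymm ?_ (le_of_forall_pos_le_add fun ε hε => ?_)
  · exact limsup_le_of_le hc (Eventually.of_forall fun n => (hu n).2)
  · have := le_limsup_of_frequently_le (h ε hε) hb
    linarith

theorem exists_nat_forall_add_le_mul_sq (c : ℕ) {ε : ℝ} (hε : 0 < ε) :
    ∃ N : ℕ, ∀ b : ℕ, N ≤ b → (b + c : ℝ) ≤ ε * ((b ^ 2 : ℕ) : ℝ) := by
  obtain ⟨N, hN⟩ := exists_nat_ge ((1 + c) / ε)
  refine ⟨N + 1, fun b hb => ?_⟩
  have hb' : (N + 1 : ℝ) ≤ b := by exact_mod_cast hb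
  rw [div_le_iff₀ hε] at hN
  have h0 : (0 : ℝ) ≤ N := Nat.cast_nonneg N
  have hc : (0 : ℝ) ≤ c := Nat.cast_nonneg c
  have h1 : (1 + c : ℝ) ≤ b * ε := hN.trans (mul_le_mul_of_nonneg_right (by linarith) hε.le)
  have h2 : (1 + c : ℝ) * b ≤ b * ε * b := mul_le_mul_of_nonneg_right h1 (by linarith)
  push_cast
  nlinarith

theorem liminf_ncard_eq_zero {P : ℕ → Prop}
    (h : ∃ᶠ b : ℕ in atTop, ∀ i, b ≤ i → i < b ^ 2 → ¬ P i) :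
    liminf (fun n : ℕ => (({i : ℕ | i < n ∧ P i}.ncard : ℝ) / n)) atTop = 0 := by
  refine liminf_eq_zero_of_frequently_le (ncard_lt_div_mem_Icc P) fun ε hε => ?_
  obtain ⟨N, hN⟩ := exists_nat_forall_add_le_mul_sq 0 hε
  rw [frequently_atTop] at h ⊢
  intro a
  obtain ⟨b, hb, hP⟩ := h (a + N + 1)
  have hb0 : 0 < b := by omega
  refine ⟨b ^ 2, by nlinarith, ?_⟩
  have hcard : {i : ℕ | i < b ^ 2 ∧ P i}.ncard ≤ b := by
    have := Set.ncard_le_ncard (s := {i : ℕ | i < b ^ 2 ∧ P i}) (t := ↑(Finset.range b))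
      (fun i hi => by
        by_contra hlt
        exact hP i (by simpa using hlt) hi.1 hi.2) (Finset.finite_toSet _)
    rwa [Set.ncard_coe_finset, Finset.card_range] at this
  have hpos : (0 : ℝ) < ((b ^ 2 : ℕ) : ℝ) := by positivity
  rw [div_le_iff₀ hpos]
  have h1 := hN b (by omega)
  have h2 : ({i : ℕ | i < b ^ 2 ∧ P i}.ncard : ℝ) ≤ b := by exact_mod_cast hcard
  simp only [Nat.cast_zero, add_zero] at h1
  exact h2.trans h1

theorem limsup_ncard_eq_one {P : ℕ → Prop} (M : ℕ)
    (h : ∃ᶠ b : ℕ in atTop, ∀ i, b + M ≤ i → i + M < b ^ 2 → P i) :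
    limsup (fun n : ℕ => (({i : ℕ | i < n ∧ P i}.ncard : ℝ) / n)) atTop = 1 := by
  refine limsup_eq_one_of_frequently_ge (ncard_lt_div_mem_Icc P) fun ε hε => ?_
  obtain ⟨N, hN⟩ := exists_nat_forall_add_le_mul_sq (2 * M) hε
  rw [frequently_atTop] at h ⊢
  intro a
  obtain ⟨b, hb, hP⟩ := h (a + N + 1)
  have hb0 : 0 < b := by omega
  refine ⟨b ^ 2, by nlinarith, ?_⟩
  have hcard : b ^ 2 ≤ {i : ℕ | i < b ^ 2 ∧ P i}.ncard + (b + 2 * M) := by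
    have := Set.ncard_le_ncard (s := ↑(Finset.Ico (b + M) (b ^ 2 - M)))
      (t := {i : ℕ | i < b ^ 2 ∧ P i})
      (fun i hi => by
        rw [Finset.mem_coe, Finset.mem_Ico] at hi
        exact ⟨by omega, hP i hi.1 (by omega)⟩)
      ((Set.finite_Iio (b ^ 2)).subset fun i hi => hi.1)
    rw [Set.ncard_coe_finset, Nat.card_Ico] at this
    omega
  have hpos : (0 : ℝ) < ((b ^ 2 : ℕ) : ℝ) := by positivity
  rw [le_div_iff₀ hpos]
  have h1 := hN b (by omega)
  have h2 : ((b ^ 2 : ℕ) : ℝ) ≤ ({i : ℕ | i < b ^ 2 ∧ P i}.ncard : ℝ) + (b + 2 * M) := by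
    exact_mod_cast hcard
  push_cast at h1 h2 ⊢
  linarith

theorem liminf_ncard_eq_one_of_eventually {P : ℕ → Prop} {M : ℕ} (h : ∀ i, M ≤ i → P i) :
    liminf (fun n : ℕ => (({i : ℕ | i < n ∧ P i}.ncard : ℝ) / n)) atTop = 1 := by
  have hlow : ∀ n : ℕ, 0 < n → 1 - (M : ℝ) / n ≤ ({i : ℕ | i < n ∧ P i}.ncard : ℝ) / n := by
    intro n hn
    have hcard : n ≤ {i : ℕ | i < n ∧ P i}.ncard + M := by
      have := Set.ncard_le_ncard (s := ↑(Finset.Ico M n)) (t := {i : ℕ | i < n ∧ P i})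
        (fun i hi => by
          rw [Finset.mem_coe, Finset.mem_Ico] at hi
          exact ⟨hi.2, h i hi.1⟩)
        ((Set.finite_Iio n).subset fun i hi => hi.1)
      rw [Set.ncard_coe_finset, Nat.card_Ico] at this
      omega
    have hn' : (0 : ℝ) < n := by exact_mod_cast hn
    rw [sub_le_iff_le_add, ← add_div, le_div_iff₀ hn', one_mul]
    exact_mod_cast hcard
  have hlim : Tendsto (fun n : ℕ => 1 - (M : ℝ) / n) atTop (𝓝 1) := by
    simpa using (tendsto_const_div_atTop_nhds_zero_nat (M : ℝ)).const_sub 1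
  refine (tendsto_of_tendsto_of_tendsto_of_le_of_le' hlim tendsto_const_nhds ?_ ?_).liminf_eq
  · filter_upwards [eventually_gt_atTop 0] with n hn using hlow n hn
  · exact Eventually.of_forall fun n => (ncard_lt_div_mem_Icc P n).2

theorem exists_of_limsup_ncard_eq_one {P : ℕ → Prop}
    (h : limsup (fun n : ℕ => (({i : ℕ | i < n ∧ P i}.ncard : ℝ) / n)) atTop = 1) :
    ∃ i, P i := by
  by_contra! hP
  simp [hP] at h

/-! ### Compatible metrics on a power of a finite discrete space -/

theorem uniformity_eq_iInf_principal {X Γ : Type*} [Finite X] [t : TopologicalSpace X]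
    [ht : DiscreteTopology X] (u : UniformSpace (Γ → X))
    (hu : u.toTopologicalSpace = Pi.topologicalSpace) :
    @uniformity _ u = ⨅ α : Γ, 𝓟 {p : (Γ → X) × (Γ → X) | p.1 α = p.2 α} := by
  obtain rfl : t = ⊥ := ht.eq_bot
  let v : UniformSpace X := ⊥
  have h : u = Pi.uniformSpace fun _ : Γ => X := unique_uniformity_of_compact hu rfl
  rw [h, Pi.uniformity]
  refine iInf_congr fun α => ?_
  change comap _ (𝓟 _) = _
  rw [comap_principal]
  congr 1

theorem IsCompatibleMetric.uniformity_basis {X Γ : Type*} [Finite X] [TopologicalSpace X]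
    [DiscreteTopology X] {d : (Γ → X) → (Γ → X) → ℝ} (hd : IsCompatibleMetric (Γ → X) d) :
    (⨅ α : Γ, 𝓟 {p : (Γ → X) × (Γ → X) | p.1 α = p.2 α}).HasBasis (fun ε : ℝ => 0 < ε)
      fun ε => {p | d p.1 p.2 < ε} := by
  obtain ⟨m, hm, hdist⟩ := hd
  rw [← uniformity_eq_iInf_principal m.toUniformSpace hm]
  have := @Metric.uniformity_basis_dist _ m.toPseudoMetricSpace
  simpa only [← hdist] using this

theorem IsCompatibleMetric.exists_pos_forall_eqOn {X Γ : Type*} [Finite X] [TopologicalSpace X]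
    [DiscreteTopology X] {d : (Γ → X) → (Γ → X) → ℝ} (hd : IsCompatibleMetric (Γ → X) d)
    {E : Set Γ} (hE : E.Finite) :
    ∃ ε > 0, ∀ u v, d u v < ε → ∀ α ∈ E, u α = v α := by
  have hmem := (hasBasis_iInf_principal_finite
    fun α : Γ => {p : (Γ → X) × (Γ → X) | p.1 α = p.2 α}).mem_of_mem hE
  obtain ⟨ε, hε, hsub⟩ := hd.uniformity_basis.mem_iff.1 hmem
  refine ⟨ε, hε, fun u v huv α hα => ?_⟩
  have huv' : (u, v) ∈ {p : (Γ → X) × (Γ → X) | d p.1 p.2 < ε} := huv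
  exact Set.mem_iInter₂.1 (hsub huv') α hα

theorem IsCompatibleMetric.exists_finite_forall_lt {X Γ : Type*} [Finite X] [TopologicalSpace X]
    [DiscreteTopology X] {d : (Γ → X) → (Γ → X) → ℝ} (hd : IsCompatibleMetric (Γ → X) d)
    {ε : ℝ} (hε : 0 < ε) :
    ∃ D : Set Γ, D.Finite ∧ ∀ u v, (∀ α ∈ D, u α = v α) → d u v < ε := by
  obtain ⟨D, hD, hsub⟩ := (hasBasis_iInf_principal_finite
    fun α : Γ => {p : (Γ → X) × (Γ → X) | p.1 α = p.2 α}).mem_iff.1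
      (hd.uniformity_basis.mem_of_mem hε)
  exact ⟨D, hD, fun u v huv => hsub (show (u, v) ∈ _ from Set.mem_iInter₂.2 huv)⟩

/-! ### Generalized shifts -/

theorem genShift_iterate_apply {X Γ : Type*} (φ : Γ → Γ) (n : ℕ) (x : Γ → X) (α : Γ) :
    (genShift φ)^[n] x α = x (φ^[n] α) := by
  induction n generalizing x with
  | zero => rfl
  | succ n ih =>
    rw [Function.iterate_succ_apply, ih, Function.iterate_succ_apply']
    rfl

theorem iterate_injective_of_not_quasiPeriodic {Γ : Type*} {φ : Γ → Γ} {θ : Γ}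
    (h : ¬ QuasiPeriodic φ θ) : Function.Injective fun n : ℕ => φ^[n] θ := by
  by_contra hinj
  obtain ⟨i, j, hij, hlt⟩ : ∃ i j : ℕ, φ^[i] θ = φ^[j] θ ∧ i < j := by
    simp only [Function.Injective, not_forall] at hinj
    obtain ⟨a, b, hab, hne⟩ := hinj
    rcases lt_or_gt_of_ne hne with hl | hl
    · exact ⟨a, b, hab, hl⟩
    · exact ⟨b, a, hab.symm, hl⟩
  refine h (((Set.finite_Iio j).image fun n => φ^[n] θ).subset ?_)
  rintro _ ⟨n, rfl⟩
  induction n using Nat.strong_induction_on with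
  | _ n ih =>
    by_cases hn : n < j
    · exact ⟨n, hn, rfl⟩
    · have : φ^[n] θ = φ^[n - j + i] θ := by
        conv_lhs => rw [show n = n - j + j by omega]
        rw [Function.iterate_add_apply, ← hij, ← Function.iterate_add_apply]
      simp only [this]
      exact ih _ (by omega)

theorem exists_not_quasiPeriodic_of_distScrambled2 {X Γ : Type*} [Finite X] [TopologicalSpace X]
    [DiscreteTopology X] {φ : Γ → Γ} {d : (Γ → X) → (Γ → X) → ℝ}
    (hd : IsCompatibleMetric (Γ → X) d) {x y : Γ → X} (h : DistScrambled2 d (genShift φ) x y) :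
    ∃ θ : Γ, ¬ QuasiPeriodic φ θ := by
  by_contra! hφ
  obtain ⟨⟨s, hs, hlt⟩, hstar⟩ := h
  obtain ⟨D, hD, hDs⟩ := hd.exists_finite_forall_lt hs
  have hE : (⋃ α ∈ D, Set.range fun n : ℕ => φ^[n] α).Finite := hD.biUnion fun α _ => hφ α
  obtain ⟨t, ht, hEt⟩ := hd.exists_pos_forall_eqOn hE
  obtain ⟨i, hi⟩ := exists_of_limsup_ncard_eq_one (hstar t ht)
  refine hlt.ne (liminf_ncard_eq_one_of_eventually (M := i) fun k hk => hDs _ _ fun α hα => ?_)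
  have := hEt _ _ hi (φ^[k - i] α) (Set.mem_biUnion hα ⟨k - i, rfl⟩)
  rwa [genShift_iterate_apply, genShift_iterate_apply, ← Function.iterate_add_apply,
    show i + (k - i) = k by omega, ← genShift_iterate_apply φ k x,
    ← genShift_iterate_apply φ k y] at this

/-- The index `k` of the block `2 ^ 2 ^ k ≤ n < 2 ^ 2 ^ (k + 1)` containing `n`. -/
def blockIndex (n : ℕ) : ℕ := Nat.log 2 (Nat.log 2 n)

theorem blockIndex_eq {k n : ℕ} (h₁ : 2 ^ 2 ^ k ≤ n) (h₂ : n < (2 ^ 2 ^ k) ^ 2) :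
    blockIndex n = k := by
  have hn : n ≠ 0 := by
    have : 0 < 2 ^ 2 ^ k := by positivity
    omega
  rw [← pow_mul, ← pow_succ] at h₂
  have h₁' : 2 ^ k ≤ Nat.log 2 n := Nat.le_log_of_pow_le one_lt_two h₁
  have h₂' : Nat.log 2 n < 2 ^ (k + 1) := Nat.log_lt_of_lt_pow hn h₂
  exact Nat.log_eq_of_pow_le_of_lt_pow h₁' h₂'

open Classical in
/-- The sequence which on the block with index `Nat.pair j m` is constantly `q` if `j = a + 1` with
`a ∈ z`, and constantly `p` otherwise. -/
noncomputable def blockSeq {X : Type*} (p q : X) (z : Set ℕ) (n : ℕ) : X :=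
  if ∃ a ∈ z, (Nat.unpair (blockIndex n)).1 = a + 1 then q else p

theorem frequently_pair_block (j : ℕ) {Q : ℕ → Prop}
    (h : ∀ b, (∀ i, b ≤ i → i < b ^ 2 → (Nat.unpair (blockIndex i)).1 = j) → Q b) :
    ∃ᶠ b in atTop, Q b := by
  rw [frequently_atTop]
  intro N
  refine ⟨2 ^ 2 ^ Nat.pair j N, ?_, h _ fun i h₁ h₂ => ?_⟩
  · exact (Nat.right_le_pair j N).trans (Nat.lt_two_pow_self.trans Nat.lt_two_pow_self).le
  · rw [blockIndex_eq h₁ h₂, Nat.unpair_pair]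

theorem frequently_blockSeq_eq {X : Type*} (p q : X) (z z' : Set ℕ) :
    ∃ᶠ b in atTop, ∀ i, b ≤ i → i < b ^ 2 → blockSeq p q z i = blockSeq p q z' i :=
  frequently_pair_block 0 fun b hb i h₁ h₂ => by simp [blockSeq, hb i h₁ h₂]

theorem frequently_blockSeq_ne {X : Type*} {p q : X} (hpq : p ≠ q) {z z' : Set ℕ} (hz : z ≠ z') :
    ∃ᶠ b in atTop, ∀ i, b ≤ i → i < b ^ 2 → blockSeq p q z i ≠ blockSeq p q z' i := by
  obtain ⟨a, ha⟩ : ∃ a, ¬ (a ∈ z ↔ a ∈ z') := by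
    by_contra! h
    exact hz (Set.ext h)
  refine frequently_pair_block (a + 1) fun b hb i h₁ h₂ => ?_
  by_cases h : a ∈ z <;> by_cases h' : a ∈ z' <;>
    simp_all [blockSeq, hpq.symm]

theorem exists_bound_forall_orbit_eq {X Γ : Type*} (φ : Γ → Γ) {θ : Γ}
    (hθ : Function.Injective fun n : ℕ => φ^[n] θ) (p : X) {D : Set Γ} (hD : D.Finite) :
    ∃ M : ℕ, ∀ (w w' : ℕ → X) (i : ℕ), M ≤ i →
      (∀ n, i ≤ n + M → n ≤ i + M → w n = w' n) → ∀ α ∈ D,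
        Function.extend (fun n : ℕ => φ^[n] θ) w (fun _ => p) (φ^[i] α) =
          Function.extend (fun n : ℕ => φ^[n] θ) w' (fun _ => p) (φ^[i] α) := by
  induction D, hD using Set.Finite.induction_on with
  | empty => exact ⟨0, by simp⟩
  | @insert β D _ _ ih =>
    obtain ⟨M, hM⟩ := ih
    obtain ⟨K, hK⟩ : ∃ K : ℕ, ∀ (w w' : ℕ → X) (i : ℕ), K ≤ i →
        (∀ n, i ≤ n + K → n ≤ i + K → w n = w' n) →
        Function.extend (fun n : ℕ => φ^[n] θ) w (fun _ => p) (φ^[i] β) =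
          Function.extend (fun n : ℕ => φ^[n] θ) w' (fun _ => p) (φ^[i] β) := by
      by_cases hβ : ∃ k m : ℕ, φ^[m] θ = φ^[k] β
      · obtain ⟨k, m, hkm⟩ := hβ
        refine ⟨k + m, fun w w' i hi hw => ?_⟩
        have : φ^[i] β = (fun n : ℕ => φ^[n] θ) (i - k + m) := by
          change φ^[i] β = φ^[i - k + m] θ
          rw [Function.iterate_add_apply, hkm, ← Function.iterate_add_apply]
          congr 2
          omega
        rw [this, hθ.extend_apply, hθ.extend_apply]
        exact hw _ (by omega) (by omega)
      · push Not at hβ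
        refine ⟨0, fun w w' i _ _ => ?_⟩
        have : ¬ ∃ n, (fun n : ℕ => φ^[n] θ) n = φ^[i] β := by
          rintro ⟨n, hn⟩
          exact hβ i n hn
        rw [Function.extend_apply' _ _ _ this, Function.extend_apply' _ _ _ this]
    refine ⟨M + K, fun w w' i hi hw α hα => ?_⟩
    rcases hα with rfl | hα
    · exact hK w w' i (by omega) fun n h₁ h₂ => hw n (by omega) (by omega)
    · exact hM w w' i (by omega) (fun n h₁ h₂ => hw n (by omega) (by omega)) α hα

theorem distScrambled1_extend_blockSeq {X Γ : Type*} [Finite X] [TopologicalSpace X]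
    [DiscreteTopology X] {φ : Γ → Γ} {d : (Γ → X) → (Γ → X) → ℝ}
    (hd : IsCompatibleMetric (Γ → X) d) {θ : Γ} (hθ : Function.Injective fun n : ℕ => φ^[n] θ)
    {p q : X} (hpq : p ≠ q) {z z' : Set ℕ} (hz : z ≠ z') :
    DistScrambled1 d (genShift φ)
      (Function.extend (fun n : ℕ => φ^[n] θ) (blockSeq p q z) fun _ => p)
      (Function.extend (fun n : ℕ => φ^[n] θ) (blockSeq p q z') fun _ => p) := by
  constructor
  · obtain ⟨s, hs, hsep⟩ := hd.exists_pos_forall_eqOn (Set.finite_singleton θ)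
    refine ⟨s, hs, liminf_ncard_eq_zero
      ((frequently_blockSeq_ne hpq hz).mono fun b hb i h₁ h₂ hlt => hb i h₁ h₂ ?_)⟩
    have := hsep _ _ hlt θ rfl
    rw [genShift_iterate_apply, genShift_iterate_apply] at this
    exact (hθ.extend_apply _ _ i).symm.trans (this.trans (hθ.extend_apply _ _ i))
  · intro s hs
    obtain ⟨D, hD, hDs⟩ := hd.exists_finite_forall_lt hs
    obtain ⟨M, hM⟩ := exists_bound_forall_orbit_eq φ hθ p hD
    refine limsup_ncard_eq_one M
      ((frequently_blockSeq_eq p q z z').mono fun b hb i h₁ h₂ => hDs _ _ fun α hα => ?_)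
    rw [genShift_iterate_apply, genShift_iterate_apply]
    exact hM _ _ i (by omega) (fun n h₃ h₄ => hb n (by omega) (by omega)) α hα

theorem exists_not_countable_distScrambledSet1 {X Γ : Type*} [Finite X] [TopologicalSpace X]
    [DiscreteTopology X] [Nontrivial X] {φ : Γ → Γ} {d : (Γ → X) → (Γ → X) → ℝ}
    (hd : IsCompatibleMetric (Γ → X) d) {θ : Γ} (h : ¬ QuasiPeriodic φ θ) :
    ∃ A : Set (Γ → X), ¬ A.Countable ∧ DistScrambledSet1 d (genShift φ) A := by
  obtain ⟨p, q, hpq⟩ := exists_pair_ne X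
  have hθ := iterate_injective_of_not_quasiPeriodic h
  let x : Set ℕ → Γ → X :=
    fun z => Function.extend (fun n : ℕ => φ^[n] θ) (blockSeq p q z) fun _ => p
  have hx : Function.Injective x := by
    intro z z' hzz'
    by_contra hz
    obtain ⟨b, hb, hne⟩ := frequently_atTop.1 (frequently_blockSeq_ne hpq hz) 2
    refine hne b le_rfl (by nlinarith) ?_
    have := congrFun hzz' (φ^[b] θ)
    exact (hθ.extend_apply _ _ b).symm.trans (this.trans (hθ.extend_apply _ _ b))
  have hnc : ¬ (Set.range x).Countable := by
    intro hc
    have : Countable (Set.range x) := hc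
    have : Countable (Set ℕ) := (Set.rangeFactorization_injective.2 hx).countable
    obtain ⟨g, hg⟩ := exists_injective_nat (Set ℕ)
    exact Function.cantor_injective g hg
  refine ⟨Set.range x, hnc, ?_, ?_⟩
  · by_contra hs
    exact hnc (Set.not_nontrivial_iff.1 hs).countable
  · rintro _ ⟨z, rfl⟩ _ ⟨z', rfl⟩ hne
    exact distScrambled1_extend_blockSeq hd hθ hpq fun hz => hne (hz ▸ rfl)

theorem DistScrambledSet1.distScrambledSet2 {Y : Type*} {d : Y → Y → ℝ} {f : Y → Y} {A : Set Y}
    (h : DistScrambledSet1 d f A) : DistScrambledSet2 d f A := by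
  refine ⟨h.1, fun x hx y hy hxy => ?_⟩
  obtain ⟨⟨s, hs, h0⟩, h1⟩ := h.2 x hx y hy hxy
  exact ⟨⟨s, hs, h0 ▸ zero_lt_one⟩, h1⟩

theorem DistScrambledSet2.exists_not_quasiPeriodic {X Γ : Type*} [Finite X] [TopologicalSpace X]
    [DiscreteTopology X] {φ : Γ → Γ} {d : (Γ → X) → (Γ → X) → ℝ} {A : Set (Γ → X)}
    (h : DistScrambledSet2 d (genShift φ) A) (hd : IsCompatibleMetric (Γ → X) d) :
    ∃ θ : Γ, ¬ QuasiPeriodic φ θ := by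
  obtain ⟨x, hx, y, hy, hxy⟩ := h.1
  exact exists_not_quasiPeriodic_of_distScrambled2 hd (h.2 x hx y hy hxy)

variable {X : Type*} [Fintype X] [TopologicalSpace X] [DiscreteTopology X] [Nontrivial X]
variable {Γ : Type*} [Countable Γ] [Nonempty Γ]
/-- for any compatible metric `d` on `X^Γ`, the properties DC^u1, DC^∞1, DC^21,
DC^u2, DC^∞2, DC^22 of `(X^Γ, σ_φ)` are each equivalent to `φ` having a non-quasi-periodic
point. -/
theorem DC_one_two_iff_exists_not_quasiPeriodic
    (φ : Γ → Γ)
    (d : (Γ → X) → (Γ → X) → ℝ) (hd : IsCompatibleMetric (Γ → X) d) :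
    ((∃ A : Set (Γ → X), ¬ A.Countable ∧ DistScrambledSet1 d (genShift (X := X) φ) A) ↔
        (∃ θ : Γ, ¬ QuasiPeriodic φ θ)) ∧
    ((∃ A : Set (Γ → X), A.Infinite ∧ DistScrambledSet1 d (genShift (X := X) φ) A) ↔
        (∃ θ : Γ, ¬ QuasiPeriodic φ θ)) ∧
    ((∃ A : Set (Γ → X), DistScrambledSet1 d (genShift (X := X) φ) A) ↔
        (∃ θ : Γ, ¬ QuasiPeriodic φ θ)) ∧
    ((∃ A : Set (Γ → X), ¬ A.Countable ∧ DistScrambledSet2 d (genShift (X := X) φ) A) ↔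
        (∃ θ : Γ, ¬ QuasiPeriodic φ θ)) ∧
    ((∃ A : Set (Γ → X), A.Infinite ∧ DistScrambledSet2 d (genShift (X := X) φ) A) ↔
        (∃ θ : Γ, ¬ QuasiPeriodic φ θ)) ∧
    ((∃ A : Set (Γ → X), DistScrambledSet2 d (genShift (X := X) φ) A) ↔
        (∃ θ : Γ, ¬ QuasiPeriodic φ θ)) := by
  have huncountable : (∃ θ : Γ, ¬ QuasiPeriodic φ θ) →
      ∃ A : Set (Γ → X), ¬ A.Countable ∧ DistScrambledSet1 d (genShift (X := X) φ) A :=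
    fun ⟨_, hθ⟩ => exists_not_countable_distScrambledSet1 hd hθ
  refine ⟨⟨?_, ?_⟩, ⟨?_, ?_⟩, ⟨?_, ?_⟩, ⟨?_, ?_⟩, ⟨?_, ?_⟩, ⟨?_, ?_⟩⟩
  · exact fun ⟨_, _, hA⟩ => hA.distScrambledSet2.exists_not_quasiPeriodic hd
  · exact huncountable
  · exact fun ⟨_, _, hA⟩ => hA.distScrambledSet2.exists_not_quasiPeriodic hd
  · exact fun h => (huncountable h).imp fun _ hA => ⟨fun hf => hA.1 hf.countable, hA.2⟩
  · exact fun ⟨_, hA⟩ => hA.distScrambledSet2.exists_not_quasiPeriodic hd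
  · exact fun h => (huncountable h).imp fun _ hA => hA.2
  · exact fun ⟨_, _, hA⟩ => hA.exists_not_quasiPeriodic hd
  · exact fun h => (huncountable h).imp fun _ hA => ⟨hA.1, hA.2.distScrambledSet2⟩
  · exact fun ⟨_, _, hA⟩ => hA.exists_not_quasiPeriodic hd
  · exact fun h => (huncountable h).imp fun _ hA =>
      ⟨fun hf => hA.1 hf.countable, hA.2.distScrambledSet2⟩
  · exact fun ⟨_, hA⟩ => hA.exists_not_quasiPeriodic hd
  · exact fun h => (huncountable h).imp fun _ hA => hA.2.distScrambledSet2
end
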